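/- Let M be a smooth manifold, h a smooth 2-form and H a closed 3-form on M. For all smooth vector fields X, Y one has [X ⊕ i_X h, Y ⊕ i_Y h]_H = [X,Y] ⊕ (i_{[X,Y]}h + i_Y i_X (dh − H)). Consequently, the graph L_h = {X ⊕ i_X h : X a smooth vector field} is closed under the H-twisted Courant bracket if and only if dh = H. -/

import Mathlib

/-!
Abstract Cartan calculus on a smooth manifold `M`, in low degrees.

`C` plays the role of the ring of smooth functions `C^∞(M)`, `V` of the smooth
vector fields `𝔛(M)`, and `Ωk` of the smooth differential `k`-forms on `M`
(`k = 1, 2, 3, 4`), together with the Lie bracket `lie` of vector fields, the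
exterior derivative `d` (`dC` on functions, `dk` on `k`-forms), and the
interior product `ι` (`ιk` contracting a `k`-form with a vector field), subject
to the standard identities of Cartan calculus.  The Lie derivative is recovered
by Cartan's magic formula `L_X = d ∘ i_X + i_X ∘ d`, and the action of a vector
field on a function is `X(f) = i_X (df)`; the fields `ι1_lie`, `ι2_lie`,
`ι3_lie` express the standard identity `i_{[X,Y]} = L_X ∘ i_Y - i_Y ∘ L_X` with
the Lie derivatives expanded through Cartan's magic formula, and `ext1`, `ext2`,
`ext3` express that a differential form vanishes iff all its contractions with
vector fields vanish.
-/
structure CartanCalculus (C V Ω1 Ω2 Ω3 Ω4 : Type*) [CommRing C] [Algebra ℝ C]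
    [AddCommGroup V] [Module ℝ V] [Module C V] [IsScalarTower ℝ C V]
    [AddCommGroup Ω1] [Module ℝ Ω1] [Module C Ω1] [IsScalarTower ℝ C Ω1]
    [AddCommGroup Ω2] [Module ℝ Ω2] [Module C Ω2] [IsScalarTower ℝ C Ω2]
    [AddCommGroup Ω3] [Module ℝ Ω3] [Module C Ω3] [IsScalarTower ℝ C Ω3]
    [AddCommGroup Ω4] [Module ℝ Ω4] [Module C Ω4] [IsScalarTower ℝ C Ω4] where
  /-- the Lie bracket of vector fields -/
  lie : V →ₗ[ℝ] V →ₗ[ℝ] V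
  /-- the exterior derivative (differential) of a smooth function -/
  dC : C →ₗ[ℝ] Ω1
  /-- the exterior derivative on 1-forms -/
  d1 : Ω1 →ₗ[ℝ] Ω2
  /-- the exterior derivative on 2-forms -/
  d2 : Ω2 →ₗ[ℝ] Ω3
  /-- the exterior derivative on 3-forms -/
  d3 : Ω3 →ₗ[ℝ] Ω4
  /-- the interior product of a vector field with a 1-form (the duality pairing) -/
  ι1 : V →ₗ[ℝ] Ω1 →ₗ[ℝ] C
  /-- the interior product of a vector field with a 2-form -/
  ι2 : V →ₗ[ℝ] Ω2 →ₗ[ℝ] Ω1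
  /-- the interior product of a vector field with a 3-form -/
  ι3 : V →ₗ[ℝ] Ω3 →ₗ[ℝ] Ω2
  /-- the interior product of a vector field with a 4-form -/
  ι4 : V →ₗ[ℝ] Ω4 →ₗ[ℝ] Ω3
  lie_skew : ∀ X Y, lie X Y = - lie Y X
  lie_jacobi : ∀ X Y Z, lie (lie X Y) Z = lie X (lie Y Z) - lie Y (lie X Z)
  lie_smul_right : ∀ (f : C) (X Y : V), lie X (f • Y) = f • lie X Y + (ι1 X (dC f)) • Y
  /-- Leibniz rule for the differential of a product of functions -/
  dC_mul : ∀ f g : C, dC (f * g) = f • dC g + g • dC f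
  d1_dC : ∀ f, d1 (dC f) = 0
  d2_d1 : ∀ ω, d2 (d1 ω) = 0
  d3_d2 : ∀ ω, d3 (d2 ω) = 0
  ι1_smul_left : ∀ (f : C) (X : V) (ω : Ω1), ι1 (f • X) ω = f * ι1 X ω
  ι1_smul_right : ∀ (f : C) (X : V) (ω : Ω1), ι1 X (f • ω) = f * ι1 X ω
  ι2_smul_left : ∀ (f : C) (X : V) (ω : Ω2), ι2 (f • X) ω = f • ι2 X ω
  ι2_smul_right : ∀ (f : C) (X : V) (ω : Ω2), ι2 X (f • ω) = f • ι2 X ω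
  ι3_smul_left : ∀ (f : C) (X : V) (ω : Ω3), ι3 (f • X) ω = f • ι3 X ω
  ι3_smul_right : ∀ (f : C) (X : V) (ω : Ω3), ι3 X (f • ω) = f • ι3 X ω
  ι4_smul_left : ∀ (f : C) (X : V) (ω : Ω4), ι4 (f • X) ω = f • ι4 X ω
  ι4_smul_right : ∀ (f : C) (X : V) (ω : Ω4), ι4 X (f • ω) = f • ι4 X ω
  ι1_ι2 : ∀ (X : V) (ω : Ω2), ι1 X (ι2 X ω) = 0
  ι2_ι3 : ∀ (X : V) (ω : Ω3), ι2 X (ι3 X ω) = 0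
  ι3_ι4 : ∀ (X : V) (ω : Ω4), ι3 X (ι4 X ω) = 0
  ι1_lie : ∀ (X Y : V) (ω : Ω1), ι1 (lie X Y) ω
      = ι1 X (dC (ι1 Y ω)) - ι1 Y (dC (ι1 X ω) + ι2 X (d1 ω))
  ι2_lie : ∀ (X Y : V) (ω : Ω2), ι2 (lie X Y) ω
      = (dC (ι1 X (ι2 Y ω)) + ι2 X (d1 (ι2 Y ω)))
        - ι2 Y (d1 (ι2 X ω) + ι3 X (d2 ω))
  ι3_lie : ∀ (X Y : V) (ω : Ω3), ι3 (lie X Y) ω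
      = (d1 (ι2 X (ι3 Y ω)) + ι3 X (d2 (ι3 Y ω)))
        - ι3 Y (d2 (ι3 X ω) + ι4 X (d3 ω))
  ext1 : ∀ ω : Ω1, (∀ X : V, ι1 X ω = 0) → ω = 0
  ext2 : ∀ ω : Ω2, (∀ X : V, ι2 X ω = 0) → ω = 0
  ext3 : ∀ ω : Ω3, (∀ X : V, ι3 X ω = 0) → ω = 0

namespace CartanCalculus

variable {C V Ω1 Ω2 Ω3 Ω4 : Type*} [CommRing C] [Algebra ℝ C]
    [AddCommGroup V] [Module ℝ V] [Module C V] [IsScalarTower ℝ C V]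
    [AddCommGroup Ω1] [Module ℝ Ω1] [Module C Ω1] [IsScalarTower ℝ C Ω1]
    [AddCommGroup Ω2] [Module ℝ Ω2] [Module C Ω2] [IsScalarTower ℝ C Ω2]
    [AddCommGroup Ω3] [Module ℝ Ω3] [Module C Ω3] [IsScalarTower ℝ C Ω3]
    [AddCommGroup Ω4] [Module ℝ Ω4] [Module C Ω4] [IsScalarTower ℝ C Ω4]
    (𝓓 : CartanCalculus C V Ω1 Ω2 Ω3 Ω4)

/-- The action `X(f) = i_X (df)` of a vector field on a smooth function. -/
def act (X : V) (f : C) : C := 𝓓.ι1 X (𝓓.dC f)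

/-- The Lie derivative of a 1-form along a vector field, via Cartan's magic
formula `L_X = d ∘ i_X + i_X ∘ d`. -/
def L1 (X : V) (ω : Ω1) : Ω1 := 𝓓.dC (𝓓.ι1 X ω) + 𝓓.ι2 X (𝓓.d1 ω)

/-- The Lie derivative of a 2-form along a vector field, via Cartan's magic
formula `L_X = d ∘ i_X + i_X ∘ d`. -/
def L2 (X : V) (ω : Ω2) : Ω2 := 𝓓.d1 (𝓓.ι2 X ω) + 𝓓.ι3 X (𝓓.d2 ω)

/-- The symmetric pairing `⟨X ⊕ ξ, Y ⊕ η⟩₊ = ½ (ξ(Y) + η(X))` on sections of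
the generalized tangent bundle `TM ⊕ T*M`. -/
noncomputable def pairPlus (A B : V × Ω1) : C := (2⁻¹ : ℝ) • (𝓓.ι1 B.1 A.2 + 𝓓.ι1 A.1 B.2)

/-- The (untwisted) Courant bracket
`[X ⊕ ξ, Y ⊕ η]_C = [X,Y] ⊕ (L_X η − L_Y ξ − ½ d(i_X η − i_Y ξ))`
on sections of `TM ⊕ T*M`. -/
noncomputable def courant (A B : V × Ω1) : V × Ω1 :=
  (𝓓.lie A.1 B.1,
    𝓓.L1 A.1 B.2 - 𝓓.L1 B.1 A.2 - (2⁻¹ : ℝ) • 𝓓.dC (𝓓.ι1 A.1 B.2 - 𝓓.ι1 B.1 A.2))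

/-- The `H`-twisted Courant bracket
`[X ⊕ ξ, Y ⊕ η]_H = [X ⊕ ξ, Y ⊕ η]_C − i_Y i_X H` on sections of `TM ⊕ T*M`. -/
noncomputable def courantH (H : Ω3) (A B : V × Ω1) : V × Ω1 :=
  ((𝓓.courant A B).1, (𝓓.courant A B).2 - 𝓓.ι2 B.1 (𝓓.ι3 A.1 H))

/-- Contractions of a 2-form with two vector fields anticommute. -/
theorem ι1_ι2_swap (X Y : V) (ω : Ω2) : 𝓓.ι1 Y (𝓓.ι2 X ω) = -𝓓.ι1 X (𝓓.ι2 Y ω) := by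
  have hXY := 𝓓.ι1_ι2 (X + Y) ω
  simp only [map_add, LinearMap.add_apply, 𝓓.ι1_ι2, zero_add, add_zero] at hXY
  exact eq_neg_of_add_eq_zero_left hXY

/-- The twisted Courant bracket of two elements of the graph of a 2-form. -/
theorem courantH_graph (h : Ω2) (H : Ω3) (X Y : V) :
    𝓓.courantH H (X, 𝓓.ι2 X h) (Y, 𝓓.ι2 Y h)
      = (𝓓.lie X Y, 𝓓.ι2 (𝓓.lie X Y) h + 𝓓.ι2 Y (𝓓.ι3 X (𝓓.d2 h - H))) := by
  have half : ∀ ω : Ω1, (2⁻¹ : ℝ) • (ω + ω) = ω := fun ω => by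
    rw [← two_smul ℝ ω, smul_smul]; norm_num
  simp only [courantH, courant, L1, 𝓓.ι2_lie, 𝓓.ι1_ι2_swap X Y, map_sub, map_add, map_neg,
    sub_neg_eq_add, half]
  congr 1
  abel

/-- A 3-form vanishes if all its double contractions with vector fields do. -/
theorem eq_zero_of_ι2_ι3 (ω : Ω3) (hω : ∀ X Y : V, 𝓓.ι2 Y (𝓓.ι3 X ω) = 0) : ω = 0 :=
  𝓓.ext3 ω fun X => 𝓓.ext2 _ fun Y => hω X Y

end CartanCalculus

open CartanCalculus

/-- For a 2-form `h` and a closed 3-form `H`, the `H`-twisted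
Courant bracket of elements of the graph of `h` is
`[X ⊕ i_X h, Y ⊕ i_Y h]_H = [X,Y] ⊕ (i_{[X,Y]} h + i_Y i_X (dh − H))`;
consequently the graph `L_h = {X ⊕ i_X h}` is closed under the `H`-twisted
Courant bracket if and only if `dh = H`. -/
theorem twisted_bracket_on_graph_and_integrability
    {C V Ω1 Ω2 Ω3 Ω4 : Type*} [CommRing C] [Algebra ℝ C]
    [AddCommGroup V] [Module ℝ V] [Module C V] [IsScalarTower ℝ C V]
    [AddCommGroup Ω1] [Module ℝ Ω1] [Module C Ω1] [IsScalarTower ℝ C Ω1]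
    [AddCommGroup Ω2] [Module ℝ Ω2] [Module C Ω2] [IsScalarTower ℝ C Ω2]
    [AddCommGroup Ω3] [Module ℝ Ω3] [Module C Ω3] [IsScalarTower ℝ C Ω3]
    [AddCommGroup Ω4] [Module ℝ Ω4] [Module C Ω4] [IsScalarTower ℝ C Ω4]
    (𝓓 : CartanCalculus C V Ω1 Ω2 Ω3 Ω4)
    (h : Ω2) (H : Ω3) (hHcl : 𝓓.d3 H = 0) :
    (∀ X Y : V,
        𝓓.courantH H (X, 𝓓.ι2 X h) (Y, 𝓓.ι2 Y h)
          = (𝓓.lie X Y, 𝓓.ι2 (𝓓.lie X Y) h + 𝓓.ι2 Y (𝓓.ι3 X (𝓓.d2 h - H))))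
    ∧ ((∀ A ∈ {p : V × Ω1 | ∃ X : V, p = (X, 𝓓.ι2 X h)},
          ∀ B ∈ {p : V × Ω1 | ∃ X : V, p = (X, 𝓓.ι2 X h)},
          𝓓.courantH H A B ∈ {p : V × Ω1 | ∃ X : V, p = (X, 𝓓.ι2 X h)})
        ↔ 𝓓.d2 h = H) := by
  refine ⟨𝓓.courantH_graph h H, fun hcl => ?_, ?_⟩
  · refine sub_eq_zero.mp (𝓓.eq_zero_of_ι2_ι3 _ fun X Y => ?_)
    obtain ⟨Z, hZ⟩ := hcl _ ⟨X, rfl⟩ _ ⟨Y, rfl⟩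
    rw [𝓓.courantH_graph, Prod.mk.injEq] at hZ
    obtain ⟨rfl, hZ⟩ := hZ
    exact add_eq_left.mp hZ
  · rintro rfl _ ⟨X, rfl⟩ _ ⟨Y, rfl⟩
    exact ⟨𝓓.lie X Y, by simp [𝓓.courantH_graph]⟩
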